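/- arXiv:1808.06944 — 3 statements merged into one kernel-verified Lean document; each statement's English description precedes it below -/
import Mathlib

section
/- Let the monotone-with-respect-to-states-and-inputs system (X, U, A, φ) satisfy: (i) there exists ρ of class K∞ such that for all x₋, x, x₊ ∈ X with x₋ ≤ x ≤ x₊ one has ‖x‖_X ≤ ρ(‖x₋‖_X + ‖x₊‖_X); and (ii) there exist η, ξ of class K∞ such that for every x ∈ X, every u ∈ A(x) and every ε > 0 there exist x₋, x₊ ∈ X, u₋ ∈ A(x₋) ∩ U_c and u₊ ∈ A(x₊) ∩ U_c with x₋ ≤ x ≤ x₊, u₋ ≤ u ≤ u₊, max(‖u₋‖_U, ‖u₊‖_U) ≤ η(‖u‖_U + ε) and max(‖x₋‖_X, ‖x₊‖_X) ≤ ξ(‖x‖_X + ‖u‖_U + ε). Then the system is ISS (with respect to all admissible inputs) if and only if it is ISS with respect to inputs in U_c. -/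
open Filter Set

/-- `γ` is of class `K`: continuous, strictly increasing on `[0,∞)` with `γ(0) = 0`. -/
def ClassK (γ : ℝ → ℝ) : Prop :=
  ContinuousOn γ (Ici 0) ∧ StrictMonoOn γ (Ici 0) ∧ γ 0 = 0

/-- `γ` is of class `K∞`: of class `K` and unbounded. -/
def ClassKInf (γ : ℝ → ℝ) : Prop :=
  ClassK γ ∧ Tendsto γ atTop atTop

/-- `β` is of class `KL`: continuous, `β(·,t)` of class `K` for every `t ≥ 0`, and for every
`r > 0` the map `β(r,·)` is strictly decreasing to `0` at infinity. -/
def ClassKL (β : ℝ → ℝ → ℝ) : Prop :=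
  ContinuousOn (fun q : ℝ × ℝ => β q.1 q.2) (Ici 0 ×ˢ Ici 0) ∧
  (∀ t ≥ (0:ℝ), ClassK fun r => β r t) ∧
  (∀ r > (0:ℝ), StrictAntiOn (fun t => β r t) (Ici 0) ∧
    Tendsto (fun t => β r t) atTop (nhds 0))

/-- `K` is a positive cone: `K ∩ (−K) = {0}`, and `K` is closed under addition and
multiplication by nonnegative reals. -/
def IsPositiveCone {V : Type*} [AddCommGroup V] [Module ℝ V] (K : Set V) : Prop :=
  K ∩ (-K) = {0} ∧
  (∀ a : ℝ, 0 ≤ a → ∀ x ∈ K, a • x ∈ K) ∧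
  (∀ x ∈ K, ∀ y ∈ K, x + y ∈ K)

/-- The partial order induced by a cone `K`: `x ≤ y` iff `y − x ∈ K`. -/
def coneLE {V : Type*} [AddCommGroup V] (K : Set V) (x y : V) : Prop := y - x ∈ K

/-- ISS with respect to inputs in `S`, for a system with admissible input sets `A(x)`:
the ISS estimate holds for every state `x` and every admissible input `u ∈ A(x) ∩ S`. -/
def ISSwrtAdm {X U : Type*} [NormedAddCommGroup X] [NormedAddCommGroup U]
    (φ : ℝ → X → U → X) (A : X → Set U) (S : Set U) : Prop :=
  ∃ β γ : _, ClassKL β ∧ ClassK γ ∧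
    ∀ x : X, ∀ u ∈ A x ∩ S, ∀ t ≥ (0:ℝ), ‖φ t x u‖ ≤ β ‖x‖ t + γ ‖u‖

theorem ClassK.nonneg' {f : ℝ → ℝ} (hf : ClassK f) {r : ℝ} (hr : 0 ≤ r) : 0 ≤ f r := by
  have := hf.2.1.monotoneOn (mem_Ici.2 le_rfl) (mem_Ici.2 hr) hr
  rwa [hf.2.2] at this

theorem ClassK.pos' {f : ℝ → ℝ} (hf : ClassK f) {r : ℝ} (hr : 0 < r) : 0 < f r := by
  have := hf.2.1 (mem_Ici.2 le_rfl) (mem_Ici.2 hr.le) hr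
  rwa [hf.2.2] at this

theorem ClassK.le' {f : ℝ → ℝ} (hf : ClassK f) {r s : ℝ} (hr : 0 ≤ r) (h : r ≤ s) : f r ≤ f s :=
  hf.2.1.monotoneOn (mem_Ici.2 hr) (mem_Ici.2 (hr.trans h)) h

theorem ClassK.comp' {f g : ℝ → ℝ} (hf : ClassK f) (hg : ClassK g) :
    ClassK (fun r => f (g r)) := by
  have hm : MapsTo g (Ici 0) (Ici 0) := fun r hr => hg.nonneg' hr
  exact ⟨hf.1.comp hg.1 hm, fun r hr s hs h => hf.2.1 (hm hr) (hm hs) (hg.2.1 hr hs h),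
    by simp only [hg.2.2, hf.2.2]⟩

theorem ClassK.add' {f g : ℝ → ℝ} (hf : ClassK f) (hg : ClassK g) :
    ClassK (fun r => f r + g r) :=
  ⟨hf.1.add hg.1, fun _ hr _ hs h => add_lt_add (hf.2.1 hr hs h) (hg.2.1 hr hs h),
    by simp only [hg.2.2, hf.2.2, add_zero]⟩

theorem classK_mul {c : ℝ} (hc : 0 < c) : ClassK (fun r => c * r) :=
  ⟨by fun_prop, fun _ _ _ _ h => by simpa using mul_lt_mul_of_pos_left h hc, by simp⟩

theorem ClassK.add_le' {f : ℝ → ℝ} (hf : ClassK f) {p q : ℝ} (hp : 0 ≤ p) (hq : 0 ≤ q) :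
    f (p + q) ≤ f (2 * p) + f (2 * q) := by
  rcases le_total p q with h | h
  · have h1 := hf.le' (r := p + q) (s := 2 * q) (by linarith) (by linarith)
    have h2 := hf.nonneg' (r := 2 * p) (by linarith)
    linarith
  · have h1 := hf.le' (r := p + q) (s := 2 * p) (by linarith) (by linarith)
    have h2 := hf.nonneg' (r := 2 * q) (by linarith)
    linarith

theorem ClassK.tendsto' {f : ℝ → ℝ} (hf : ClassK f) {a : ℝ} (ha : 0 ≤ a) :
    Tendsto (fun ε => f (a + ε)) (nhdsWithin 0 (Ioi 0)) (nhds (f a)) := by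
  have h := hf.1 a ha
  refine Tendsto.comp h (tendsto_nhdsWithin_iff.2 ⟨?_, ?_⟩)
  · have : Tendsto (fun ε : ℝ => a + ε) (nhds 0) (nhds (a + 0)) :=
      Continuous.tendsto (by fun_prop) 0
    rw [add_zero] at this
    exact this.mono_left nhdsWithin_le_nhds
  · filter_upwards [self_mem_nhdsWithin] with ε hε
    have : (0:ℝ) < ε := hε
    exact mem_Ici.2 (by linarith)

theorem classK_limit {f g : ℝ → ℝ} (hf : ClassK f) (hg : ClassK g) {a b y : ℝ} (ha : 0 ≤ a)
    (hb : 0 ≤ b) (h : ∀ ε > 0, y ≤ f (a + ε) + g (b + ε)) : y ≤ f a + g b := by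
  refine ge_of_tendsto ((hf.tendsto' ha).add (hg.tendsto' hb)) ?_
  filter_upwards [self_mem_nhdsWithin] with ε hε using h ε hε

theorem ClassKL.anti' {β : ℝ → ℝ → ℝ} (h : ClassKL β) {r t : ℝ} (hr : 0 ≤ r) (ht : 0 ≤ t) :
    β r t ≤ β r 0 := by
  rcases hr.eq_or_lt with rfl | hr
  · have h1 := (h.2.1 t ht).2.2
    have h2 := (h.2.1 0 le_rfl).2.2
    simp only at h1 h2
    rw [h1, h2]
  · exact (h.2.2 r hr).1.antitoneOn (mem_Ici.2 le_rfl) (mem_Ici.2 ht) ht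

theorem ClassKL.comp' {β : ℝ → ℝ → ℝ} (h : ClassKL β) {f g : ℝ → ℝ} (hf : ClassK f)
    (hg : ClassK g) : ClassKL (fun r t => f (β (g r) t)) := by
  refine ⟨?_, fun t ht => hf.comp' ((h.2.1 t ht).comp' hg), fun r hr => ⟨?_, ?_⟩⟩
  · have h1 : ContinuousOn (fun q : ℝ × ℝ => (g q.1, q.2)) (Ici 0 ×ˢ Ici 0) :=
      (hg.1.comp continuousOn_fst (fun q hq => hq.1)).prodMk continuousOn_snd
    have h2 := h.1.comp h1 (fun q hq => ⟨hg.nonneg' hq.1, hq.2⟩)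
    exact hf.1.comp h2 (fun q hq => (h.2.1 q.2 hq.2).nonneg' (hg.nonneg' hq.1))
  · intro s hs t ht hst
    have hgr := hg.pos' hr
    exact hf.2.1 ((h.2.1 t ht).nonneg' hgr.le) ((h.2.1 s hs).nonneg' hgr.le)
      ((h.2.2 _ hgr).1 hs ht hst)
  · have hgr := hg.pos' hr
    have h0 := hf.1 0 (mem_Ici.2 le_rfl)
    have h1 : Tendsto f (nhdsWithin 0 (Ici 0)) (nhds 0) := by
      have := h0.tendsto
      rwa [hf.2.2] at this
    refine h1.comp (tendsto_nhdsWithin_iff.2 ⟨(h.2.2 _ hgr).2, ?_⟩)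
    filter_upwards [eventually_ge_atTop 0] with t ht using (h.2.1 t ht).nonneg' hgr.le

/-- A system monotone w.r.t. states and inputs satisfying the sandwich
property (i) and the approximation property (ii) is ISS (w.r.t. all admissible inputs) iff
it is ISS w.r.t. inputs in `Uc`. -/
theorem stmt3 {X U : Type*}
    [NormedAddCommGroup X] [NormedSpace ℝ X]
    [NormedAddCommGroup U] [NormedSpace ℝ U]
    (KX : Set X) (KU : Set U)
    (hKX : IsPositiveCone KX) (hKU : IsPositiveCone KU)
    (Uc : Set U) (A : X → Set U)
    (φ : ℝ → X → U → X)
    (hmono : ∀ t ≥ (0:ℝ), ∀ x₁ x₂ : X, coneLE KX x₁ x₂ →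
      ∀ u₁ ∈ A x₁, ∀ u₂ ∈ A x₂, coneLE KU u₁ u₂ →
        coneLE KX (φ t x₁ u₁) (φ t x₂ u₂))
    (ρ : ℝ → ℝ) (hρ : ClassKInf ρ)
    (hsandwich : ∀ xm x xp : X, coneLE KX xm x → coneLE KX x xp →
      ‖x‖ ≤ ρ (‖xm‖ + ‖xp‖))
    (η ξ : ℝ → ℝ) (hη : ClassKInf η) (hξ : ClassKInf ξ)
    (happrox : ∀ x : X, ∀ u ∈ A x, ∀ ε > (0:ℝ),
      ∃ xm xp : X, ∃ um ∈ A xm ∩ Uc, ∃ up ∈ A xp ∩ Uc,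
        coneLE KX xm x ∧ coneLE KX x xp ∧
        coneLE KU um u ∧ coneLE KU u up ∧
        max ‖um‖ ‖up‖ ≤ η (‖u‖ + ε) ∧
        max ‖xm‖ ‖xp‖ ≤ ξ (‖x‖ + ‖u‖ + ε)) :
    ISSwrtAdm φ A (univ : Set U) ↔ ISSwrtAdm φ A Uc := by
  constructor
  · rintro ⟨β, γ, hβ, hγ, h⟩
    exact ⟨β, γ, hβ, hγ, fun x u hu t ht => h x u ⟨hu.1, mem_univ _⟩ t ht⟩
  rintro ⟨β, γ, hβ, hγ, h⟩
  have hρ := hρ.1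
  have hη := hη.1
  have hξ := hξ.1
  have m2 : ClassK (fun r => 2 * r) := classK_mul two_pos
  have hβ' := hβ.comp' (hρ.comp' (m2.comp' m2)) (hξ.comp' m2)
  have hq : ClassK (fun r => 2 * β (ξ (2 * r)) 0 + 2 * γ (η r)) :=
    (m2.comp' ((hβ.2.1 0 le_rfl).comp' (hξ.comp' m2))).add' (m2.comp' (hγ.comp' hη))
  have hγ' := (hρ.comp' m2).comp' hq
  refine ⟨_, _, hβ', hγ', fun x u hu t ht => ?_⟩
  refine classK_limit (hβ'.2.1 t ht) hγ' (norm_nonneg x) (norm_nonneg u) fun ε hε => ?_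
  obtain ⟨xm, xp, um, hum, up, hup, h1, h2, h3, h4, h5, h6⟩ := happrox x u hu.1 ε hε
  have ha := norm_nonneg x
  have hb := norm_nonneg u
  have kt := hβ.2.1 t ht
  have hs := hsandwich _ _ _ (hmono t ht _ _ h1 um hum.1 u hu.1 h3)
    (hmono t ht _ _ h2 u hu.1 up hup.1 h4)
  have em := h xm um hum t ht
  have ep := h xp up hup t ht
  have e1 := kt.le' (norm_nonneg xm) ((le_max_left _ _).trans h6)
  have e2 := kt.le' (norm_nonneg xp) ((le_max_right _ _).trans h6)
  have e3 := hγ.le' (norm_nonneg um) ((le_max_left _ _).trans h5)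
  have e4 := hγ.le' (norm_nonneg up) ((le_max_right _ _).trans h5)
  have e5 := (kt.comp' hξ).le' (r := ‖x‖ + ‖u‖ + ε) (s := (‖x‖ + ε) + (‖u‖ + ε))
    (by linarith) (by linarith)
  have e6 := (kt.comp' hξ).add_le' (p := ‖x‖ + ε) (q := ‖u‖ + ε) (by linarith) (by linarith)
  have e7 := hβ.anti' (hξ.nonneg' (r := 2 * (‖u‖ + ε)) (by linarith)) ht
  have hp0 := kt.nonneg' (hξ.nonneg' (r := 2 * (‖x‖ + ε)) (by linarith))
  have hq0 := hq.nonneg' (r := ‖u‖ + ε) (by linarith)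
  have e8 := hρ.le' (r := ‖φ t xm um‖ + ‖φ t xp up‖)
    (s := 2 * β (ξ (2 * (‖x‖ + ε))) t +
      (2 * β (ξ (2 * (‖u‖ + ε))) 0 + 2 * γ (η (‖u‖ + ε)))) (by positivity) (by linarith)
  exact hs.trans (e8.trans (hρ.add_le' (by linarith) hq0))
end

section
/- Uniqueness of classical solutions: let L be uniformly parabolic and assume that for every bounded set W ⊂ ℝ there is a constant k > 0 such that for every w₁, w₂ ∈ W with w₁ > w₂, every z ∈ G and every ξ ∈ ℝⁿ one has f(z, w₁, ξ) − f(z, w₂, ξ) < k(w₁ − w₂). If x, y ∈ C⁰(closure(D)) ∩ C^{1,2}(D) satisfy (Lx)(t,z) = (Ly)(t,z) = 0 for all (t,z) ∈ D, x(0,z) = y(0,z) for all z ∈ G, and x(t,z) = y(t,z) for all (t,z) ∈ [0,T] × ∂G, then x = y on closure(D). -/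
open MeasureTheory Set Filter

noncomputable section

/-- The `i`-th coordinate direction in `ℝⁿ`. -/
def edir (n : ℕ) (i : Fin n) : EuclideanSpace ℝ (Fin n) := EuclideanSpace.single i (1:ℝ)

/-- Second partial derivative `∂²u/(∂z_i ∂z_j)` at `z`. -/
def pder2 {n : ℕ} (u : EuclideanSpace ℝ (Fin n) → ℝ) (z : EuclideanSpace ℝ (Fin n))
    (i j : Fin n) : ℝ :=
  fderiv ℝ (fun w => fderiv ℝ u w (edir n i)) z (edir n j)

/-- Gradient `∇u(z)`, viewed as a vector of `ℝⁿ`. -/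
def grad {n : ℕ} (u : EuclideanSpace ℝ (Fin n) → ℝ) (z : EuclideanSpace ℝ (Fin n)) :
    EuclideanSpace ℝ (Fin n) :=
  (WithLp.equiv 2 (Fin n → ℝ)).symm fun i => fderiv ℝ u z (edir n i)

/-- The parabolic operator
`(Lx)(t,z) = ∂x/∂t(t,z) − Σ_{i,j} a_{ij}(z) ∂²x/(∂z_i∂z_j)(t,z) − f(z, x(t,z), ∇_z x(t,z))`. -/
def Lop {n : ℕ} (a : Fin n → Fin n → EuclideanSpace ℝ (Fin n) → ℝ)
    (f : EuclideanSpace ℝ (Fin n) → ℝ → EuclideanSpace ℝ (Fin n) → ℝ)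
    (x : ℝ → EuclideanSpace ℝ (Fin n) → ℝ) (t : ℝ) (z : EuclideanSpace ℝ (Fin n)) : ℝ :=
  deriv (fun s => x s z) t
    - ∑ i, ∑ j, a i j z * pder2 (x t) z i j
    - f z (x t z) (grad (x t) z)

/-- `x ∈ C^{1,2}(D)`: once continuously differentiable in `t` and twice continuously
differentiable in `z` on `D`. -/
def C12On {n : ℕ} (x : ℝ → EuclideanSpace ℝ (Fin n) → ℝ)
    (D : Set (ℝ × EuclideanSpace ℝ (Fin n))) : Prop :=
  (∀ p ∈ D, DifferentiableAt ℝ (fun s => x s p.2) p.1) ∧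
  ContinuousOn (fun p : ℝ × EuclideanSpace ℝ (Fin n) => deriv (fun s => x s p.2) p.1) D ∧
  (∀ p ∈ D, DifferentiableAt ℝ (x p.1) p.2) ∧
  (∀ p ∈ D, DifferentiableAt ℝ (fun w => fderiv ℝ (x p.1) w) p.2) ∧
  ContinuousOn
    (fun p : ℝ × EuclideanSpace ℝ (Fin n) => fderiv ℝ (fun w => fderiv ℝ (x p.1) w) p.2) D

/-- `L` is uniformly parabolic: `Σ_{i,j} a_{ij}(z) ξ_i ξ_j ≥ K|ξ|²` on `closure G`. -/
def UniformlyParabolic {n : ℕ} (G : Set (EuclideanSpace ℝ (Fin n)))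
    (a : Fin n → Fin n → EuclideanSpace ℝ (Fin n) → ℝ) : Prop :=
  ∃ K > (0:ℝ), ∀ z ∈ closure G, ∀ ξ : EuclideanSpace ℝ (Fin n),
    K * ‖ξ‖ ^ 2 ≤ ∑ i, ∑ j, a i j z * ξ i * ξ j

/-- For every bounded `W ⊂ ℝ` there is `k > 0` with
`f(z,w₁,ξ) − f(z,w₂,ξ) < k(w₁ − w₂)` for all `w₁ > w₂` in `W`, `z ∈ G`, `ξ ∈ ℝⁿ`. -/
def OneSidedLip {n : ℕ} (G : Set (EuclideanSpace ℝ (Fin n)))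
    (f : EuclideanSpace ℝ (Fin n) → ℝ → EuclideanSpace ℝ (Fin n) → ℝ) : Prop :=
  ∀ W : Set ℝ, Bornology.IsBounded W → ∃ k > (0:ℝ),
    ∀ w₁ ∈ W, ∀ w₂ ∈ W, w₂ < w₁ → ∀ z ∈ G, ∀ ξ : EuclideanSpace ℝ (Fin n),
      f z w₁ ξ - f z w₂ ξ < k * (w₁ - w₂)

open Topology in
/-- A local maximum has nonpositive second derivative in every direction. -/
theorem hess_nonpos_of_isLocalMax {E : Type*} [NormedAddCommGroup E] [NormedSpace ℝ E]
    (u : E → ℝ) (z ξ : E) (h1 : ∀ᶠ w in 𝓝 z, DifferentiableAt ℝ u w)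
    (h2 : DifferentiableAt ℝ (fun w => fderiv ℝ u w) z) (hm : IsLocalMax u z) :
    fderiv ℝ (fun w => fderiv ℝ u w) z ξ ξ ≤ 0 := by
  have hline : ∀ s : ℝ, HasDerivAt (fun s : ℝ => z + s • ξ) ξ s := by
    intro s
    simpa using ((hasDerivAt_id s).smul_const ξ).const_add z
  have ht : Tendsto (fun s : ℝ => z + s • ξ) (𝓝 0) (𝓝 z) := by
    have := (hline 0).continuousAt.tendsto
    simpa using this
  set g : ℝ → ℝ := fun s => u (z + s • ξ) with hg
  have hd1 : ∀ᶠ s in 𝓝 (0:ℝ), HasDerivAt g (fderiv ℝ u (z + s • ξ) ξ) s := by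
    filter_upwards [ht.eventually h1] with s hs
    exact hs.hasFDerivAt.comp_hasDerivAt s (hline s)
  have hde : deriv g =ᶠ[𝓝 0] fun s => fderiv ℝ u (z + s • ξ) ξ := by
    filter_upwards [hd1] with s hs using hs.deriv
  have h2' : HasFDerivAt (fun w => fderiv ℝ u w) (fderiv ℝ (fun w => fderiv ℝ u w) z)
      (z + (0:ℝ) • ξ) := by
    simpa using h2.hasFDerivAt
  have hdd : HasDerivAt (fun s : ℝ => fderiv ℝ u (z + s • ξ) ξ)
      (fderiv ℝ (fun w => fderiv ℝ u w) z ξ ξ) 0 := by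
    have h3 : HasFDerivAt (fun w => fderiv ℝ u w ξ)
        ((fderiv ℝ (fun w => fderiv ℝ u w) z).flip ξ) (z + (0:ℝ) • ξ) := by
      have := h2'.clm_apply (hasFDerivAt_const ξ (z + (0:ℝ) • ξ))
      simpa using this
    have h4 := HasFDerivAt.comp_hasDerivAt (l := fun w => fderiv ℝ u w ξ) (0:ℝ) h3 (hline 0)
    rw [ContinuousLinearMap.flip_apply] at h4
    exact h4
  have hdd' : deriv (deriv g) 0 = fderiv ℝ (fun w => fderiv ℝ u w) z ξ ξ := by
    rw [hde.deriv_eq]; exact hdd.deriv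
  have hgm : IsLocalMax g 0 := by
    have := ht.eventually hm
    filter_upwards [this] with s hs
    simpa [hg] using hs
  by_contra hpos
  push Not at hpos
  have hmin : IsLocalMin g 0 :=
    isLocalMin_of_deriv_deriv_pos (by rw [hdd']; exact hpos) hgm.deriv_eq_zero
      hd1.self_of_nhds.continuousAt
  have hconst : g =ᶠ[𝓝 0] fun _ => g 0 := by
    filter_upwards [hgm, hmin] with s h h' using le_antisymm h h'
  have h0 : deriv (deriv g) 0 = 0 := by
    rw [hconst.deriv.deriv_eq]; simp
  rw [hdd'] at h0
  linarith

open scoped MatrixOrder in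
/-- Trace inequality: `Σ a_ij H_ij ≤ 0` for `a` nonnegative and `H` symmetric nonpositive. -/
theorem sum_mul_nonpos {n : ℕ} (a H : Matrix (Fin n) (Fin n) ℝ)
    (ha : ∀ ξ : Fin n → ℝ, 0 ≤ ∑ i, ∑ j, a i j * ξ i * ξ j)
    (hs : ∀ i j, H i j = H j i)
    (hH : ∀ ξ : Fin n → ℝ, ∑ i, ∑ j, H i j * ξ i * ξ j ≤ 0) :
    ∑ i, ∑ j, a i j * H i j ≤ 0 := by
  have hp : (-H).PosSemidef := by
    refine Matrix.PosSemidef.of_dotProduct_mulVec_nonneg ?_ ?_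
    · ext i j
      simp [Matrix.conjTranspose_apply, hs i j]
    · intro ξ
      have := hH ξ
      have e : star ξ ⬝ᵥ ((-H).mulVec ξ) = - ∑ i, ∑ j, H i j * ξ i * ξ j := by
        simp only [dotProduct, Matrix.mulVec, Finset.mul_sum, ← Finset.sum_neg_distrib]
        refine Finset.sum_congr rfl fun i _ => Finset.sum_congr rfl fun j _ => ?_
        simp
        ring
      rw [e]; linarith
  obtain ⟨B, hB⟩ := CStarAlgebra.nonneg_iff_eq_star_mul_self.mp hp.nonneg
  have hB' : ∀ i j, H i j = - ∑ l, B l i * B l j := by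
    intro i j
    have := congrFun (congrFun hB i) j
    simp [Matrix.mul_apply, Matrix.star_apply] at this
    linarith
  have : ∑ i, ∑ j, a i j * H i j = - ∑ l, ∑ i, ∑ j, a i j * B l i * B l j := by
    rw [Finset.sum_comm (s := (Finset.univ : Finset (Fin n))) (t := Finset.univ)
      (f := fun l i => ∑ j, a i j * B l i * B l j), ← Finset.sum_neg_distrib]
    refine Finset.sum_congr rfl fun i _ => ?_
    rw [Finset.sum_comm, ← Finset.sum_neg_distrib]
    refine Finset.sum_congr rfl fun j _ => ?_
    rw [hB', mul_neg, Finset.mul_sum]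
    congr 1
    exact Finset.sum_congr rfl fun l _ => by ring
  rw [this]
  have := Finset.sum_nonneg fun l (_ : l ∈ (Finset.univ : Finset (Fin n))) => ha (B l)
  linarith

theorem pder2_eq {n : ℕ} (u : EuclideanSpace ℝ (Fin n) → ℝ) (z : EuclideanSpace ℝ (Fin n))
    (h2 : DifferentiableAt ℝ (fun w => fderiv ℝ u w) z) (i j : Fin n) :
    pder2 u z i j = fderiv ℝ (fun w => fderiv ℝ u w) z (edir n j) (edir n i) := by
  have := h2.hasFDerivAt.clm_apply (hasFDerivAt_const (edir n i) z)
  unfold pder2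
  rw [this.fderiv]
  simp

theorem sum_edir {n : ℕ} (ξ : Fin n → ℝ) :
    ∀ (H : EuclideanSpace ℝ (Fin n) →L[ℝ] EuclideanSpace ℝ (Fin n) →L[ℝ] ℝ),
    ∑ i, ∑ j, H (edir n j) (edir n i) * ξ i * ξ j =
      H (∑ i, ξ i • edir n i) (∑ i, ξ i • edir n i) := by
  intro H
  simp only [map_sum, map_smul, sum_apply, smul_apply,
    smul_eq_mul, Finset.mul_sum]
  refine Finset.sum_congr rfl fun i _ => Finset.sum_congr rfl fun j _ => ?_
  ring

open Topology in
/-- The one-sided comparison on `D`. -/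
theorem compare_aux {n : ℕ} (G : Set (EuclideanSpace ℝ (Fin n)))
    (hGopen : IsOpen G) (hGbdd : Bornology.IsBounded G)
    (T : ℝ) (hT : 0 < T)
    (a : Fin n → Fin n → EuclideanSpace ℝ (Fin n) → ℝ)
    (f : EuclideanSpace ℝ (Fin n) → ℝ → EuclideanSpace ℝ (Fin n) → ℝ)
    (hpar : UniformlyParabolic G a)
    (hlip : OneSidedLip G f)
    (x y : ℝ → EuclideanSpace ℝ (Fin n) → ℝ)
    (hxC : ContinuousOn (fun p : ℝ × EuclideanSpace ℝ (Fin n) => x p.1 p.2)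
      (closure (Ioo 0 T ×ˢ G)))
    (hyC : ContinuousOn (fun p : ℝ × EuclideanSpace ℝ (Fin n) => y p.1 p.2)
      (closure (Ioo 0 T ×ˢ G)))
    (hx12 : C12On x (Ioo 0 T ×ˢ G)) (hy12 : C12On y (Ioo 0 T ×ˢ G))
    (hLx : ∀ p ∈ Ioo 0 T ×ˢ G, Lop a f x p.1 p.2 = 0)
    (hLy : ∀ p ∈ Ioo 0 T ×ˢ G, Lop a f y p.1 p.2 = 0)
    (hinit : ∀ z ∈ G, x 0 z = y 0 z)
    (hbdry : ∀ t ∈ Icc 0 T, ∀ z ∈ frontier G, x t z = y t z) :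
    ∀ p ∈ Ioo 0 T ×ˢ G, x p.1 p.2 ≤ y p.1 p.2 := by
  rintro ⟨t0, z0⟩ ⟨⟨ht0, ht0T⟩, hz0⟩
  simp only at ht0 ht0T hz0 ⊢
  by_contra hlt
  push Not at hlt
  have hcl : closure (Ioo 0 T ×ˢ G) = Icc 0 T ×ˢ closure G := by
    rw [closure_prod_eq, closure_Ioo hT.ne]
  rw [hcl] at hxC hyC
  have hKG : IsCompact (closure G) := hGbdd.isCompact_closure
  have hK : IsCompact (Icc 0 T ×ˢ closure G) := isCompact_Icc.prod hKG
  obtain ⟨k, hk, hkf⟩ := hlip _ ((hK.image_of_continuousOn hxC).isBounded.union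
    (hK.image_of_continuousOn hyC).isBounded)
  obtain ⟨T', ht0T', hT'T⟩ := exists_between ht0T
  have hsub : Icc 0 T' ×ˢ closure G ⊆ Icc 0 T ×ˢ closure G :=
    prod_mono (Icc_subset_Icc_right hT'T.le) subset_rfl
  obtain ⟨⟨t, z⟩, ⟨⟨htn, htT'⟩, hzc⟩, hmax⟩ :=
    (isCompact_Icc.prod hKG : IsCompact (Icc 0 T' ×ˢ closure G)).exists_isMaxOn
      ⟨(t0, z0), ⟨ht0.le, ht0T'.le⟩, subset_closure hz0⟩
      (f := fun p : ℝ × EuclideanSpace ℝ (Fin n) =>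
        Real.exp (-k * p.1) * (x p.1 p.2 - y p.1 p.2))
      ((by fun_prop : Continuous fun p : ℝ × EuclideanSpace ℝ (Fin n) =>
        Real.exp (-k * p.1)).continuousOn.mul ((hxC.sub hyC).mono hsub))
  simp only at htn htT' hzc
  have hmax' : ∀ s w, 0 ≤ s → s ≤ T' → w ∈ closure G →
      Real.exp (-k * s) * (x s w - y s w) ≤ Real.exp (-k * t) * (x t z - y t z) :=
    fun s w h1 h2 h3 => hmax (show (s, w) ∈ Icc 0 T' ×ˢ closure G from ⟨⟨h1, h2⟩, h3⟩)
  have hpos : 0 < x t z - y t z := by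
    have h1 := hmax' t0 z0 ht0.le ht0T'.le (subset_closure hz0)
    have h2 : 0 < Real.exp (-k * t0) * (x t0 z0 - y t0 z0) :=
      mul_pos (Real.exp_pos _) (by linarith)
    exact (mul_pos_iff_of_pos_left (Real.exp_pos _)).mp (h2.trans_le h1)
  have htT : t < T := htT'.trans_lt hT'T
  have hzG : z ∈ G := by
    by_contra hz
    have : z ∈ frontier G := by rw [hGopen.frontier_eq]; exact ⟨hzc, hz⟩
    have := hbdry t ⟨htn, htT.le⟩ z this
    linarith
  have ht : 0 < t := by
    rcases htn.eq_or_lt with h | h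
    · subst h
      have := hinit z hzG
      linarith
    · exact h
  have hD : (t, z) ∈ Ioo 0 T ×ˢ G := ⟨⟨ht, htT⟩, hzG⟩
  obtain ⟨hxt, -, hxz, hxzz, -⟩ := hx12
  obtain ⟨hyt, -, hyz, hyzz, -⟩ := hy12
  have dxt := (hxt _ hD).hasDerivAt
  have dyt := (hyt _ hD).hasDerivAt
  have hxz' : ∀ w ∈ G, DifferentiableAt ℝ (x t) w := fun w hw => hxz (t, w) ⟨⟨ht, htT⟩, hw⟩
  have hyz' : ∀ w ∈ G, DifferentiableAt ℝ (y t) w := fun w hw => hyz (t, w) ⟨⟨ht, htT⟩, hw⟩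
  have dxzz := hxzz _ hD
  have dyzz := hyzz _ hD
  simp only at dxt dyt dxzz dyzz
  have hGn : G ∈ 𝓝 z := hGopen.mem_nhds hzG
  -- time derivative
  have htime : k * (x t z - y t z) ≤ deriv (fun s => x s z) t - deriv (fun s => y s z) t := by
    have he : HasDerivAt (fun s => Real.exp (-k * s)) (Real.exp (-k * t) * (-k)) t := by
      simpa using ((hasDerivAt_id t).const_mul (-k)).exp
    have hv := he.mul (dxt.sub dyt)
    have hm : IsLocalMaxOn
        ((fun s => Real.exp (-k * s)) * ((fun s => x s z) - (fun s => y s z))) (Icc 0 t) t := by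
      apply IsMaxOn.localize
      intro s hs
      exact hmax' s z hs.1 (hs.2.trans htT') hzc
    have := hm.hasFDerivWithinAt_nonpos hv.hasFDerivAt.hasFDerivWithinAt
      (y := 0 - t) (sub_mem_posTangentConeAt_of_segment_subset (by
        rw [segment_symm, segment_eq_Icc ht.le]))
    simp at this
    have hE := Real.exp_pos (-(k * t))
    by_contra hc
    push Not at hc
    have h3 : 0 < Real.exp (-(k * t)) * t *
      (k * (x t z - y t z) - (deriv (fun s => x s z) t - deriv (fun s => y s z) t)) :=
      mul_pos (mul_pos hE ht) (by linarith)
    nlinarith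
  -- space derivatives
  set u : EuclideanSpace ℝ (Fin n) → ℝ := fun w => x t w - y t w with hu
  have hum : IsLocalMax u z := by
    filter_upwards [hGn] with w hw
    exact le_of_mul_le_mul_left (hmax' t w ht.le htT' (subset_closure hw)) (Real.exp_pos _)
  have hu1 : ∀ᶠ w in 𝓝 z, DifferentiableAt ℝ u w := by
    filter_upwards [hGn] with w hw using (hxz' w hw).sub (hyz' w hw)
  have hue : (fun w => fderiv ℝ u w) =ᶠ[𝓝 z] fun w => fderiv ℝ (x t) w - fderiv ℝ (y t) w := by
    filter_upwards [hGn] with w hw using fderiv_fun_sub (hxz' w hw) (hyz' w hw)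
  have hu2 : HasFDerivAt (fun w => fderiv ℝ u w) (fderiv ℝ (fun w => fderiv ℝ (x t) w) z -
      fderiv ℝ (fun w => fderiv ℝ (y t) w) z) z :=
    (dxzz.hasFDerivAt.sub dyzz.hasFDerivAt).congr_of_eventuallyEq hue
  have hgrad : grad (x t) z = grad (y t) z := by
    have h0 := hum.fderiv_eq_zero
    have h1 := hue.self_of_nhds
    simp only at h1
    rw [h0] at h1
    have : fderiv ℝ (x t) z = fderiv ℝ (y t) z := (sub_eq_zero.mp h1.symm)
    simp only [grad, this]
  have hsym : ∀ v w, fderiv ℝ (fun w => fderiv ℝ u w) z v w =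
      fderiv ℝ (fun w => fderiv ℝ u w) z w v :=
    second_derivative_symmetric_of_eventually (f := u)
      (hu1.mono fun w hw => hw.hasFDerivAt) hu2.differentiableAt.hasFDerivAt
  have hsum : ∑ i, ∑ j, a i j z * (pder2 (x t) z i j - pder2 (y t) z i j) ≤ 0 := by
    have hP : ∀ i j, pder2 (x t) z i j - pder2 (y t) z i j =
        fderiv ℝ (fun w => fderiv ℝ u w) z (edir n j) (edir n i) := by
      intro i j
      rw [pder2_eq _ _ dxzz, pder2_eq _ _ dyzz, hu2.fderiv]
      simp
    simp only [hP]
    refine sum_mul_nonpos (fun i j => a i j z)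
      (fun i j => fderiv ℝ (fun w => fderiv ℝ u w) z (edir n j) (edir n i)) ?_ ?_ ?_
    · intro ξ
      obtain ⟨K, hK, hKa⟩ := hpar
      have := hKa z hzc (WithLp.toLp 2 ξ)
      refine le_trans (by positivity) this
    · intro i j
      exact hsym _ _
    · intro ξ
      rw [sum_edir]
      exact hess_nonpos_of_isLocalMax u z _ hu1 hu2.differentiableAt hum
  have hx0 := hLx _ hD
  have hy0 := hLy _ hD
  simp only [Lop] at hx0 hy0
  have hf := hkf (x t z) (Or.inl ⟨(t, z), ⟨⟨htn, htT.le⟩, hzc⟩, rfl⟩) (y t z)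
    (Or.inr ⟨(t, z), ⟨⟨htn, htT.le⟩, hzc⟩, rfl⟩) (by linarith) z hzG (grad (y t) z)
  rw [hgrad] at hx0
  simp only [mul_sub, Finset.sum_sub_distrib] at hsum
  linarith

/-- **uniqueness of classical solutions.** Let `L` be uniformly parabolic with
one-sided Lipschitz nonlinearity, `D = (0,T) × G`. If `x, y ∈ C⁰(closure D) ∩ C^{1,2}(D)`
satisfy `Lx = Ly = 0` on `D`, agree at `t = 0` on `G` and agree on `[0,T] × ∂G`, then
`x = y` on `closure D`. -/
theorem stmt7 {n : ℕ} (G : Set (EuclideanSpace ℝ (Fin n)))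
    (hGne : G.Nonempty) (hGopen : IsOpen G) (hGbdd : Bornology.IsBounded G)
    (T : ℝ) (hT : 0 < T)
    (a : Fin n → Fin n → EuclideanSpace ℝ (Fin n) → ℝ)
    (ha : ∀ i j, ContinuousOn (a i j) (closure G))
    (f : EuclideanSpace ℝ (Fin n) → ℝ → EuclideanSpace ℝ (Fin n) → ℝ)
    (hf : ContinuousOn
      (fun q : EuclideanSpace ℝ (Fin n) × ℝ × EuclideanSpace ℝ (Fin n) => f q.1 q.2.1 q.2.2)
      (G ×ˢ (univ : Set ℝ) ×ˢ (univ : Set (EuclideanSpace ℝ (Fin n)))))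
    (hpar : UniformlyParabolic G a)
    (hlip : OneSidedLip G f)
    (x y : ℝ → EuclideanSpace ℝ (Fin n) → ℝ)
    (hxC : ContinuousOn (fun p : ℝ × EuclideanSpace ℝ (Fin n) => x p.1 p.2)
      (closure (Ioo 0 T ×ˢ G)))
    (hyC : ContinuousOn (fun p : ℝ × EuclideanSpace ℝ (Fin n) => y p.1 p.2)
      (closure (Ioo 0 T ×ˢ G)))
    (hx12 : C12On x (Ioo 0 T ×ˢ G)) (hy12 : C12On y (Ioo 0 T ×ˢ G))
    (hLx : ∀ p ∈ Ioo 0 T ×ˢ G, Lop a f x p.1 p.2 = 0)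
    (hLy : ∀ p ∈ Ioo 0 T ×ˢ G, Lop a f y p.1 p.2 = 0)
    (hinit : ∀ z ∈ G, x 0 z = y 0 z)
    (hbdry : ∀ t ∈ Icc 0 T, ∀ z ∈ frontier G, x t z = y t z) :
    ∀ p ∈ closure (Ioo 0 T ×ˢ G), x p.1 p.2 = y p.1 p.2 := by
  have h1 := compare_aux G hGopen hGbdd T hT a f hpar hlip x y hxC hyC hx12 hy12 hLx hLy
    hinit hbdry
  have h2 := compare_aux G hGopen hGbdd T hT a f hpar hlip y x hyC hxC hy12 hx12 hLy hLx
    (fun z hz => (hinit z hz).symm) (fun t ht z hz => (hbdry t ht z hz).symm)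
  exact Set.EqOn.of_subset_closure (fun p hp => le_antisymm (h1 p hp) (h2 p hp)) hxC hyC
    subset_closure subset_rfl


end
end

section
/- Under hypotheses (H1), (H2) and (H3), the following are equivalent: (i) the boundary-input system is exp-ISS with respect to all admissible inputs, i.e. there exist M > 0, a > 0 and γ of class K∞ such that ‖φ(t,x₀,u)‖_p ≤ M e^{−at} ‖x₀‖_p + γ(sup_{s,z} |u(s,z)|) for every x₀ ∈ X, u ∈ A(x₀) and t ≥ 0; (ii) the boundary-input system is exp-ISS with respect to inputs that are constant in time and space; (iii) there exist M > 0, a > 0 and γ of class K∞ such that ‖φ(t, y₀ + c, c) − c‖_p ≤ M e^{−at} ‖y₀‖_p + γ(|c|) for every y₀ ∈ X with y₀ = 0 on ∂G, every constant c ∈ ℝ (identified with the constant function on closure(G) and the constant boundary input) and every t ≥ 0. -/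
open Filter Set MeasureTheory ENNReal

noncomputable section

/-- A boundary input: a bounded continuous function on `ℝ≥0 × ∂G`. -/
def IsBdryInput {n : ℕ} (G : Set (EuclideanSpace ℝ (Fin n)))
    (u : ℝ → EuclideanSpace ℝ (Fin n) → ℝ) : Prop :=
  ContinuousOn (fun q : ℝ × EuclideanSpace ℝ (Fin n) => u q.1 q.2) (Ici 0 ×ˢ frontier G) ∧
  ∃ C : ℝ, ∀ t ≥ (0:ℝ), ∀ z ∈ frontier G, |u t z| ≤ C

/-- The `L^p(G)` norm of a state. -/
def Xnorm {n : ℕ} (G : Set (EuclideanSpace ℝ (Fin n))) (p : ℝ≥0∞)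
    (x : EuclideanSpace ℝ (Fin n) → ℝ) : ℝ :=
  (eLpNorm x p (volume.restrict G)).toReal

/-- The sup-norm `sup_{t ≥ 0, z ∈ ∂G} |u(t,z)|` of a boundary input. -/
def bdryNorm {n : ℕ} (G : Set (EuclideanSpace ℝ (Fin n)))
    (u : ℝ → EuclideanSpace ℝ (Fin n) → ℝ) : ℝ :=
  sSup ((fun q : ℝ × EuclideanSpace ℝ (Fin n) => |u q.1 q.2|) '' (Ici 0 ×ˢ frontier G))

/-- Inputs that are constant in time and space on the boundary. -/
def ConstInputs {n : ℕ} (G : Set (EuclideanSpace ℝ (Fin n))) :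
    Set (ℝ → EuclideanSpace ℝ (Fin n) → ℝ) :=
  {u | ∃ c : ℝ, ∀ t ≥ (0:ℝ), ∀ z ∈ frontier G, u t z = c}

/-- ISS of the boundary-input system with respect to inputs in `S`. -/
def BdryISSwrt {n : ℕ} (G : Set (EuclideanSpace ℝ (Fin n))) (p : ℝ≥0∞)
    (X : Set (EuclideanSpace ℝ (Fin n) → ℝ))
    (A : (EuclideanSpace ℝ (Fin n) → ℝ) → Set (ℝ → EuclideanSpace ℝ (Fin n) → ℝ))
    (φ : (EuclideanSpace ℝ (Fin n) → ℝ) → (ℝ → EuclideanSpace ℝ (Fin n) → ℝ) →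
      ℝ → EuclideanSpace ℝ (Fin n) → ℝ)
    (S : Set (ℝ → EuclideanSpace ℝ (Fin n) → ℝ)) : Prop :=
  ∃ β γ : _, ClassKL β ∧ ClassK γ ∧
    ∀ x₀ ∈ X, ∀ u ∈ A x₀ ∩ S, ∀ t ≥ (0:ℝ),
      Xnorm G p (φ x₀ u t) ≤ β (Xnorm G p x₀) t + γ (bdryNorm G u)

/-- exp-ISS of the boundary-input system with respect to inputs in `S`. -/
def BdryExpISSwrt {n : ℕ} (G : Set (EuclideanSpace ℝ (Fin n))) (p : ℝ≥0∞)
    (X : Set (EuclideanSpace ℝ (Fin n) → ℝ))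
    (A : (EuclideanSpace ℝ (Fin n) → ℝ) → Set (ℝ → EuclideanSpace ℝ (Fin n) → ℝ))
    (φ : (EuclideanSpace ℝ (Fin n) → ℝ) → (ℝ → EuclideanSpace ℝ (Fin n) → ℝ) →
      ℝ → EuclideanSpace ℝ (Fin n) → ℝ)
    (S : Set (ℝ → EuclideanSpace ℝ (Fin n) → ℝ)) : Prop :=
  ∃ M > (0:ℝ), ∃ a > (0:ℝ), ∃ γ : ℝ → ℝ, ClassKInf γ ∧
    ∀ x₀ ∈ X, ∀ u ∈ A x₀ ∩ S, ∀ t ≥ (0:ℝ),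
      Xnorm G p (φ x₀ u t) ≤ M * Real.exp (-a * t) * Xnorm G p x₀ + γ (bdryNorm G u)

/-- The left derivative at a left-sided maximum is nonnegative. -/
lemma aux_left_deriv {w : ℝ → ℝ} {w' t : ℝ} (ht : 0 < t) (hd : HasDerivAt w w' t)
    (hmax : ∀ s, 0 ≤ s → s ≤ t → w s ≤ w t) : 0 ≤ w' := by
  have h1 := (hd.hasDerivWithinAt (s := Iio t))
  rw [hasDerivWithinAt_iff_tendsto_slope' (by simp)] at h1
  refine ge_of_tendsto h1 ?_
  have : Ioo 0 t ∈ nhdsWithin t (Iio t) := Ioo_mem_nhdsLT ht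
  filter_upwards [this] with s hs
  rw [slope_def_field]
  have := hmax s hs.1.le hs.2.le
  exact div_nonneg_of_nonpos (by linarith) (by linarith [hs.2])

/-- Second derivative test, necessary condition, one variable. -/
lemma aux_second_1d {g : ℝ → ℝ} (hmax : IsLocalMax g 0) (hc : ContinuousAt g 0) :
    deriv (deriv g) 0 ≤ 0 := by
  by_contra! h
  have h1 : deriv g 0 = 0 := hmax.deriv_eq_zero
  have h2 : IsLocalMin g 0 := isLocalMin_of_deriv_deriv_pos h h1 hc
  have h3 : g =ᶠ[nhds 0] fun _ => g 0 := by
    filter_upwards [hmax, h2] with s a b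
    exact le_antisymm a b
  have h4 := h3.deriv
  have h5 := h4.deriv_eq
  simp at h5
  linarith

/-- Second derivative test, necessary condition. -/
lemma aux_second {E : Type*} [NormedAddCommGroup E] [NormedSpace ℝ E] {d : E → ℝ} {z : E}
    (hmax : IsLocalMax d z) (hd : ∀ᶠ w in nhds z, DifferentiableAt ℝ d w)
    (hd2 : DifferentiableAt ℝ (fderiv ℝ d) z) (v : E) :
    fderiv ℝ (fderiv ℝ d) z v v ≤ 0 := by
  have hline : ∀ s : ℝ, HasDerivAt (fun s : ℝ => z + s • v) v s := by
    intro s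
    simpa using ((hasDerivAt_id s).smul_const v).const_add z
  have hcont : Tendsto (fun s : ℝ => z + s • v) (nhds 0) (nhds z) := by
    have := (hline 0).continuousAt.tendsto
    simpa using this
  have hg : ∀ᶠ s in nhds (0:ℝ), deriv (fun s : ℝ => d (z + s • v)) s
      = fderiv ℝ d (z + s • v) v := by
    filter_upwards [hcont.eventually hd] with s hs
    exact (hs.hasFDerivAt.comp_hasDerivAt s (hline s)).deriv
  have hmax' : IsLocalMax (fun s : ℝ => d (z + s • v)) 0 := by
    have := hcont.eventually hmax
    filter_upwards [this] with s hs
    simpa using hs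
  have hc : ContinuousAt (fun s : ℝ => d (z + s • v)) 0 := by
    have := hd.self_of_nhds.continuousAt.tendsto.comp hcont
    simpa [ContinuousAt, Function.comp_def] using this
  have key := aux_second_1d hmax' hc
  have e : deriv (deriv (fun s : ℝ => d (z + s • v))) 0 = fderiv ℝ (fderiv ℝ d) z v v := by
    rw [(show deriv (fun s : ℝ => d (z + s • v)) =ᶠ[nhds 0]
      fun s => fderiv ℝ d (z + s • v) v from hg).deriv_eq]
    have h0 : HasFDerivAt (fderiv ℝ d) (fderiv ℝ (fderiv ℝ d) z) (z + (0:ℝ) • v) := by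
      simpa using hd2.hasFDerivAt
    have h1 := h0.comp_hasDerivAt (0:ℝ) (hline 0)
    exact (h1.clm_apply (hasDerivAt_const (0:ℝ) v)).deriv.trans (by simp)
  rwa [e] at key

/-- Trace inequality: nonnegative quadratic form against a negative semidefinite matrix. -/
lemma aux_trace {n : ℕ} (a H : Fin n → Fin n → ℝ)
    (ha : ∀ ξ : Fin n → ℝ, 0 ≤ ∑ i, ∑ j, a i j * ξ i * ξ j)
    (hs : ∀ i j, H i j = H j i)
    (hH : ∀ ξ : Fin n → ℝ, ∑ i, ∑ j, H i j * ξ i * ξ j ≤ 0) :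
    ∑ i, ∑ j, a i j * H i j ≤ 0 := by
  have hP : (Matrix.of fun i j => - H i j).PosSemidef := by
    refine Matrix.PosSemidef.of_dotProduct_mulVec_nonneg ?_ ?_
    · ext i j
      simp [hs i j]
    · intro ξ
      have : star ξ ⬝ᵥ (Matrix.of fun i j => - H i j).mulVec ξ
          = - ∑ i, ∑ j, H i j * ξ i * ξ j := by
        simp only [dotProduct, Matrix.mulVec, Finset.mul_sum, ← Finset.sum_neg_distrib]
        refine Finset.sum_congr rfl fun i _ => Finset.sum_congr rfl fun j _ => ?_
        simp
        ring
      rw [this]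
      linarith [hH ξ]
  open scoped MatrixOrder Matrix.Norms.L2Operator in
  obtain ⟨B, hB⟩ := CStarAlgebra.nonneg_iff_eq_star_mul_self.1 hP.nonneg
  have hB' : ∀ i j, H i j = - ∑ k, B k i * B k j := by
    intro i j
    have := congrFun (congrFun hB i) j
    simp [Matrix.mul_apply, Matrix.star_apply] at this
    linarith
  have : ∑ i, ∑ j, a i j * H i j = - ∑ k, ∑ i, ∑ j, a i j * B k i * B k j := by
    simp only [hB', ← Finset.sum_neg_distrib, Finset.mul_sum]
    conv_rhs => rw [Finset.sum_comm]
    refine Finset.sum_congr rfl fun i _ => ?_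
    conv_rhs => rw [Finset.sum_comm]
    refine Finset.sum_congr rfl fun j _ => ?_
    refine Finset.sum_congr rfl fun k _ => ?_
    ring
  rw [this]
  have : 0 ≤ ∑ k, ∑ i, ∑ j, a i j * B k i * B k j :=
    Finset.sum_nonneg fun k _ => ha (B k)
  linarith

/-- Comparison principle for classical solutions. -/
lemma aux_comparison {n : ℕ} {G : Set (EuclideanSpace ℝ (Fin n))}
    (hGopen : IsOpen G) (hGbdd : Bornology.IsBounded G)
    {a : Fin n → Fin n → EuclideanSpace ℝ (Fin n) → ℝ}
    (hpar : UniformlyParabolic G a)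
    {f : EuclideanSpace ℝ (Fin n) → ℝ → EuclideanSpace ℝ (Fin n) → ℝ}
    (hlip : OneSidedLip G f)
    {x y : ℝ → EuclideanSpace ℝ (Fin n) → ℝ}
    (hxc : ContinuousOn (fun q : ℝ × EuclideanSpace ℝ (Fin n) => x q.1 q.2)
      (Ici 0 ×ˢ closure G))
    (hyc : ContinuousOn (fun q : ℝ × EuclideanSpace ℝ (Fin n) => y q.1 q.2)
      (Ici 0 ×ˢ closure G))
    (hx12 : C12On x (Ioi 0 ×ˢ G)) (hy12 : C12On y (Ioi 0 ×ˢ G))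
    (hxL : ∀ q ∈ (Ioi (0:ℝ)) ×ˢ G, Lop a f x q.1 q.2 = 0)
    (hyL : ∀ q ∈ (Ioi (0:ℝ)) ×ˢ G, Lop a f y q.1 q.2 = 0)
    (h0 : ∀ z ∈ G, x 0 z ≤ y 0 z)
    (hb : ∀ t ≥ (0:ℝ), ∀ z ∈ frontier G, x t z ≤ y t z) :
    ∀ t ≥ (0:ℝ), ∀ z ∈ closure G, x t z ≤ y t z := by
  intro t0 ht0 z0 hz0
  by_contra! hlt
  set K : Set (ℝ × EuclideanSpace ℝ (Fin n)) := Icc 0 t0 ×ˢ closure G with hK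
  have hKc : IsCompact K := isCompact_Icc.prod hGbdd.isCompact_closure
  have hKsub : K ⊆ Ici 0 ×ˢ closure G := prod_mono Icc_subset_Ici_self subset_rfl
  have hxK := hxc.mono hKsub
  have hyK := hyc.mono hKsub
  obtain ⟨k, hk, hkf⟩ := hlip _
    ((hKc.image_of_continuousOn hxK).isBounded.union (hKc.image_of_continuousOn hyK).isBounded)
  have hwc : ContinuousOn (fun q : ℝ × EuclideanSpace ℝ (Fin n) =>
      Real.exp (-k * q.1) * (x q.1 q.2 - y q.1 q.2)) K := by
    refine ContinuousOn.mul ?_ (hxK.sub hyK)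
    fun_prop
  have hmem0 : ((t0, z0) : ℝ × EuclideanSpace ℝ (Fin n)) ∈ K := ⟨⟨ht0, le_rfl⟩, hz0⟩
  obtain ⟨⟨t, z⟩, htz, hmax⟩ := hKc.exists_isMaxOn ⟨_, hmem0⟩ hwc
  have hmax' : ∀ s ∈ Icc 0 t0, ∀ w ∈ closure G,
      Real.exp (-k * s) * (x s w - y s w) ≤ Real.exp (-k * t) * (x t z - y t z) :=
    fun s hs w hw => hmax (show (s, w) ∈ K from ⟨hs, hw⟩)
  have hpos : 0 < x t z - y t z := by
    have h1 := hmax' t0 hmem0.1 z0 hz0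
    have h2 : 0 < Real.exp (-k * t0) * (x t0 z0 - y t0 z0) :=
      mul_pos (Real.exp_pos _) (by linarith)
    exact pos_of_mul_pos_right (h2.trans_le h1) (Real.exp_pos _).le
  have hzc : z ∈ closure G := htz.2
  have ht : t ∈ Icc 0 t0 := htz.1
  have hzG : z ∈ G := by
    by_contra hz
    have : z ∈ frontier G := by
      rw [hGopen.frontier_eq]; exact ⟨hzc, hz⟩
    linarith [hb t ht.1 z this]
  have htpos : 0 < t := by
    rcases ht.1.lt_or_eq with h | h
    · exact h
    · subst h; linarith [h0 z hzG]
  have hq : ((t, z) : ℝ × EuclideanSpace ℝ (Fin n)) ∈ (Ioi (0:ℝ)) ×ˢ G := ⟨htpos, hzG⟩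
  -- spatial maximum
  have hev : ∀ᶠ w in nhds z, w ∈ G := hGopen.mem_nhds hzG
  have hlm : IsLocalMax (fun w => x t w - y t w) z := by
    filter_upwards [hev] with w hw
    have := hmax' t ht w (subset_closure hw)
    exact le_of_mul_le_mul_left this (Real.exp_pos _)
  have hdx : ∀ w ∈ G, DifferentiableAt ℝ (x t) w := fun w hw => hx12.2.2.1 (t, w) ⟨htpos, hw⟩
  have hdy : ∀ w ∈ G, DifferentiableAt ℝ (y t) w := fun w hw => hy12.2.2.1 (t, w) ⟨htpos, hw⟩
  have hdx2 : DifferentiableAt ℝ (fderiv ℝ (x t)) z := hx12.2.2.2.1 (t, z) hq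
  have hdy2 : DifferentiableAt ℝ (fderiv ℝ (y t)) z := hy12.2.2.2.1 (t, z) hq
  have hfd : ∀ w ∈ G, fderiv ℝ (fun w => x t w - y t w) w = fderiv ℝ (x t) w - fderiv ℝ (y t) w :=
    fun w hw => fderiv_fun_sub (hdx w hw) (hdy w hw)
  have hfde : fderiv ℝ (fun w => x t w - y t w) =ᶠ[nhds z]
      fun w => fderiv ℝ (x t) w - fderiv ℝ (y t) w := by
    filter_upwards [hev] with w hw using hfd w hw
  have hgrad : fderiv ℝ (x t) z = fderiv ℝ (y t) z := by
    have h1 := hlm.fderiv_eq_zero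
    rw [hfd z hzG] at h1
    exact sub_eq_zero.1 h1
  have hdd : ∀ᶠ w in nhds z, DifferentiableAt ℝ (fun w => x t w - y t w) w := by
    filter_upwards [hev] with w hw using (hdx w hw).sub (hdy w hw)
  have hdd2 : DifferentiableAt ℝ (fderiv ℝ (fun w => x t w - y t w)) z :=
    (hdx2.sub hdy2).congr_of_eventuallyEq hfde
  have hsec := aux_second hlm hdd hdd2
  set D := fderiv ℝ (fderiv ℝ (fun w => x t w - y t w)) z with hD
  have hDeq : D = fderiv ℝ (fderiv ℝ (x t)) z - fderiv ℝ (fderiv ℝ (y t)) z := by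
    rw [hD, hfde.fderiv_eq]
    exact fderiv_fun_sub hdx2 hdy2
  have hsymm : ∀ v w, D v w = D w v := by
    intro v w
    refine second_derivative_symmetric_of_eventually (f := fun w => x t w - y t w)
      (f' := fderiv ℝ (fun w => x t w - y t w)) (x := z) ?_ hdd2.hasFDerivAt v w
    filter_upwards [hdd] with w hw using hw.hasFDerivAt
  have hp2 : ∀ (u : EuclideanSpace ℝ (Fin n) → ℝ) (_ : DifferentiableAt ℝ (fderiv ℝ u) z) (i j),
      pder2 u z i j = fderiv ℝ (fderiv ℝ u) z (edir n j) (edir n i) := by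
    intro u hu i j
    unfold pder2
    have := (hu.hasFDerivAt.clm_apply (hasFDerivAt_const (edir n i) z)).fderiv
    rw [this]
    simp
  have htr : ∑ i, ∑ j, a i j z * D (edir n j) (edir n i) ≤ 0 := by
    refine aux_trace (fun i j => a i j z) (fun i j => D (edir n j) (edir n i)) ?_
      (fun i j => hsymm _ _) ?_
    · intro ξ
      obtain ⟨K0, hK0, hKξ⟩ := hpar
      have := hKξ z hzc (WithLp.toLp 2 ξ)
      exact le_trans (by positivity) this
    · intro ξ
      have := hsec (∑ i, ξ i • edir n i)
      refine le_trans (le_of_eq ?_) this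
      simp only [map_sum, map_smul, _root_.sum_apply, _root_.smul_apply,
        smul_eq_mul]
      rw [Finset.sum_congr rfl fun i _ => rfl]
      refine Finset.sum_congr rfl fun i _ => ?_
      rw [Finset.mul_sum]
      refine Finset.sum_congr rfl fun j _ => ?_
      ring
  -- temporal maximum
  have hxt : DifferentiableAt ℝ (fun s => x s z) t := hx12.1 (t, z) hq
  have hyt : DifferentiableAt ℝ (fun s => y s z) t := hy12.1 (t, z) hq
  have hexp : HasDerivAt (fun s : ℝ => Real.exp (-k * s)) (Real.exp (-k * t) * (-k)) t := by
    have := ((hasDerivAt_id t).const_mul (-k)).exp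
    simpa using this
  have hwd := hexp.mul (hxt.hasDerivAt.sub hyt.hasDerivAt)
  have hnn := aux_left_deriv htpos hwd
    (fun s hs hst => hmax' s ⟨hs, hst.trans ht.2⟩ z hzc)
  have hnn' : 0 ≤ Real.exp (-k * t) *
      (deriv (fun s => x s z) t - deriv (fun s => y s z) t - k * (x t z - y t z)) := by
    refine hnn.trans (le_of_eq ?_)
    simp only [Pi.sub_apply]
    ring
  have hnn2 := nonneg_of_mul_nonneg_right hnn' (Real.exp_pos _)
  have hLx := hxL _ hq
  have hLy := hyL _ hq
  simp only [Lop] at hLx hLy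
  have hgr : grad (x t) z = grad (y t) z := by unfold grad; rw [hgrad]
  rw [hgr] at hLx
  have hff := hkf (x t z) (Or.inl ⟨(t, z), htz, rfl⟩) (y t z) (Or.inr ⟨(t, z), htz, rfl⟩)
    (by linarith) z hzG (grad (y t) z)
  have hsum : ∑ i, ∑ j, a i j z * D (edir n j) (edir n i)
      = ∑ i, ∑ j, a i j z * pder2 (x t) z i j - ∑ i, ∑ j, a i j z * pder2 (y t) z i j := by
    rw [← Finset.sum_sub_distrib]
    refine Finset.sum_congr rfl fun i _ => ?_
    rw [← Finset.sum_sub_distrib]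
    refine Finset.sum_congr rfl fun j _ => ?_
    rw [hp2 _ hdx2, hp2 _ hdy2, hDeq]
    simp
    ring
  linarith

lemma aux_memLp {n : ℕ} {G : Set (EuclideanSpace ℝ (Fin n))}
    (hGopen : IsOpen G) (hGbdd : Bornology.IsBounded G) (p : ℝ≥0∞)
    {x : EuclideanSpace ℝ (Fin n) → ℝ} (hx : ContinuousOn x (closure G)) :
    MemLp x p (volume.restrict G) := by
  have : IsFiniteMeasure (volume.restrict G) := ⟨by simpa using hGbdd.measure_lt_top⟩
  obtain ⟨C, hC⟩ := hGbdd.isCompact_closure.exists_bound_of_continuousOn hx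
  refine MemLp.of_bound ((hx.mono subset_closure).aestronglyMeasurable hGopen.measurableSet) C ?_
  filter_upwards [ae_restrict_mem hGopen.measurableSet] with z hz
  exact hC z (subset_closure hz)

lemma aux_Xnorm_le {n : ℕ} {G : Set (EuclideanSpace ℝ (Fin n))}
    (hGopen : IsOpen G) (hGbdd : Bornology.IsBounded G) {p : ℝ≥0∞} (hp : 1 ≤ p)
    {h x y : EuclideanSpace ℝ (Fin n) → ℝ} (hx : ContinuousOn x (closure G))
    (hy : ContinuousOn y (closure G)) (hle : ∀ z ∈ G, |h z| ≤ |x z| + |y z|) :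
    Xnorm G p h ≤ Xnorm G p x + Xnorm G p y := by
  have mx := (aux_memLp hGopen hGbdd p hx).norm
  have my := (aux_memLp hGopen hGbdd p hy).norm
  unfold Xnorm
  rw [← eLpNorm_norm x, ← eLpNorm_norm y, ← ENNReal.toReal_add mx.eLpNorm_ne_top my.eLpNorm_ne_top]
  refine ENNReal.toReal_mono (ENNReal.add_ne_top.2 ⟨mx.eLpNorm_ne_top, my.eLpNorm_ne_top⟩) ?_
  refine le_trans ?_ (eLpNorm_add_le mx.aestronglyMeasurable my.aestronglyMeasurable hp)
  refine eLpNorm_mono_ae ?_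
  filter_upwards [ae_restrict_mem hGopen.measurableSet] with z hz
  simp only [Pi.add_apply, Real.norm_eq_abs]
  exact (hle z hz).trans (le_abs_self _)

lemma aux_Xnorm_congr {n : ℕ} {G : Set (EuclideanSpace ℝ (Fin n))}
    (hGopen : IsOpen G) {p : ℝ≥0∞} {x y : EuclideanSpace ℝ (Fin n) → ℝ}
    (h : ∀ z ∈ G, x z = y z) : Xnorm G p x = Xnorm G p y := by
  unfold Xnorm
  congr 1
  refine eLpNorm_congr_ae ?_
  filter_upwards [ae_restrict_mem hGopen.measurableSet] with z hz using h z hz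

lemma aux_Xnorm_const {n : ℕ} (G : Set (EuclideanSpace ℝ (Fin n))) (p : ℝ≥0∞) (c : ℝ) :
    Xnorm G p (fun _ => c) = Xnorm G p (fun _ => 1) * |c| := by
  unfold Xnorm
  have : (fun _ : EuclideanSpace ℝ (Fin n) => c) = c • (fun _ => (1:ℝ)) := by
    ext; simp
  rw [this, eLpNorm_const_smul, ENNReal.toReal_mul]
  simp [mul_comm]

lemma aux_KInf {γ : ℝ → ℝ} (h : ClassKInf γ) {c d : ℝ} (hc : 0 ≤ c) (hd : 0 < d) :
    ClassKInf (fun r => c * r + d * γ r) := by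
  obtain ⟨⟨h1, h2, h3⟩, h4⟩ := h
  refine ⟨⟨?_, ?_, by simp [h3]⟩, ?_⟩
  · exact (continuousOn_const.mul continuousOn_id).add (continuousOn_const.mul h1)
  · intro r hr s hs hrs
    have := h2 hr hs hrs
    have := mul_lt_mul_of_pos_left this hd
    have := mul_le_mul_of_nonneg_left hrs.le hc
    simp only
    linarith
  · refine tendsto_atTop_mono' atTop ?_ (h4.const_mul_atTop hd)
    filter_upwards [eventually_ge_atTop (0:ℝ)] with r hr
    have := mul_nonneg hc hr
    linarith

lemma aux_K_nonneg {γ : ℝ → ℝ} (h : ClassKInf γ) {r : ℝ} (hr : 0 ≤ r) : 0 ≤ γ r := by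
  have := h.1.2.1.monotoneOn (mem_Ici.2 le_rfl) (mem_Ici.2 hr) hr
  rwa [h.1.2.2] at this

lemma aux_bdryNorm_ge {n : ℕ} {G : Set (EuclideanSpace ℝ (Fin n))}
    {u : ℝ → EuclideanSpace ℝ (Fin n) → ℝ} (hu : IsBdryInput G u) {t : ℝ} (ht : 0 ≤ t)
    {z : EuclideanSpace ℝ (Fin n)} (hz : z ∈ frontier G) : |u t z| ≤ bdryNorm G u := by
  obtain ⟨C, hC⟩ := hu.2
  refine le_csSup ⟨C, ?_⟩ ⟨(t, z), ⟨ht, hz⟩, rfl⟩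
  rintro _ ⟨⟨s, w⟩, ⟨hs, hw⟩, rfl⟩
  exact hC s hs w hw

lemma aux_bdryNorm_nonneg {n : ℕ} (G : Set (EuclideanSpace ℝ (Fin n)))
    (u : ℝ → EuclideanSpace ℝ (Fin n) → ℝ) : 0 ≤ bdryNorm G u := by
  refine Real.sSup_nonneg ?_
  rintro _ ⟨q, _, rfl⟩
  exact abs_nonneg _

lemma aux_bdryNorm_le {n : ℕ} {G : Set (EuclideanSpace ℝ (Fin n))}
    {u : ℝ → EuclideanSpace ℝ (Fin n) → ℝ} {c : ℝ}
    (hu : ∀ t ≥ (0:ℝ), ∀ z ∈ frontier G, u t z = c) : bdryNorm G u ≤ |c| := by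
  refine Real.sSup_le ?_ (abs_nonneg _)
  rintro _ ⟨⟨s, w⟩, ⟨hs, hw⟩, rfl⟩
  simp only
  rw [hu s hs w hw]

lemma aux_constInput {n : ℕ} (G : Set (EuclideanSpace ℝ (Fin n))) (c : ℝ) :
    IsBdryInput G (fun _ _ => c) :=
  ⟨continuousOn_const, |c|, fun _ _ _ _ => le_rfl⟩

/-- Near the boundary a continuous function is almost bounded by its boundary bound. -/
lemma aux_near {n : ℕ} {G : Set (EuclideanSpace ℝ (Fin n))}
    (hGbdd : Bornology.IsBounded G) (hne : (frontier G).Nonempty)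
    {x : EuclideanSpace ℝ (Fin n) → ℝ} (hx : ContinuousOn x (closure G)) {U ε : ℝ}
    (hε : 0 < ε) (hU : ∀ z ∈ frontier G, |x z| ≤ U) :
    ∃ δ > 0, ∀ z ∈ closure G, Metric.infDist z (frontier G) < δ → |x z| ≤ U + ε := by
  have huc := hGbdd.isCompact_closure.uniformContinuousOn_of_continuous hx
  obtain ⟨δ, hδ, h⟩ := Metric.uniformContinuousOn_iff.1 huc ε hε
  refine ⟨δ, hδ, fun z hz hd => ?_⟩
  obtain ⟨w, hw, hzw⟩ := (Metric.infDist_lt_iff hne).1 hd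
  have h1 := h z hz w (frontier_subset_closure hw) hzw
  rw [Real.dist_eq] at h1
  have h2 := hU w hw
  have h3 : |x z| ≤ |x z - x w| + |x w| := by simpa using abs_add_le (x z - x w) (x w)
  linarith

/-- Under (H1), (H2), (H3), the following are equivalent:
(i) the boundary-input parabolic system is exp-ISS w.r.t. all admissible inputs;
(ii) it is exp-ISS w.r.t. inputs constant in time and space;
(iii) the transformed system with constant distributed inputs is exp-ISS:
`‖φ(t, y₀ + c, c) − c‖_p ≤ M e^{−at} ‖y₀‖_p + γ(|c|)` for all `y₀ ∈ X` vanishing on `∂G`,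
all constants `c ∈ ℝ` and all `t ≥ 0`. -/
theorem stmt11 {n : ℕ} (G : Set (EuclideanSpace ℝ (Fin n)))
    (hGne : G.Nonempty) (hGopen : IsOpen G) (hGbdd : Bornology.IsBounded G)
    (p : ℝ≥0∞) (hp : 1 ≤ p)
    (a : Fin n → Fin n → EuclideanSpace ℝ (Fin n) → ℝ)
    (ha : ∀ i j, ContinuousOn (a i j) (closure G))
    (hpar : UniformlyParabolic G a)
    (f : EuclideanSpace ℝ (Fin n) → ℝ → EuclideanSpace ℝ (Fin n) → ℝ)
    (hf : ContinuousOn (fun q : EuclideanSpace ℝ (Fin n) × ℝ × EuclideanSpace ℝ (Fin n) =>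
      f q.1 q.2.1 q.2.2)
      ((closure G) ×ˢ (univ : Set ℝ) ×ˢ (univ : Set (EuclideanSpace ℝ (Fin n)))))
    -- Hypothesis (H2)
    (hlip : OneSidedLip G f)
    (hfdiff : ∀ z ∈ closure G,
      ContDiff ℝ 1 fun q : ℝ × EuclideanSpace ℝ (Fin n) => f z q.1 q.2)
    (X : Set (EuclideanSpace ℝ (Fin n) → ℝ))
    (A : (EuclideanSpace ℝ (Fin n) → ℝ) → Set (ℝ → EuclideanSpace ℝ (Fin n) → ℝ))
    (φ : (EuclideanSpace ℝ (Fin n) → ℝ) → (ℝ → EuclideanSpace ℝ (Fin n) → ℝ) →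
      ℝ → EuclideanSpace ℝ (Fin n) → ℝ)
    -- Hypothesis (H1): the state space
    (hXcont : ∀ x ∈ X, ContinuousOn x (closure G))
    (hXconst : ∀ c : ℝ, (fun _ => c) ∈ X)
    (hXadd : ∀ x ∈ X, ∀ y ∈ X, (fun z => x z + y z) ∈ X)
    (hXsmul : ∀ c : ℝ, ∀ x ∈ X, (fun z => c * x z) ∈ X)
    -- Hypothesis (H1): admissible inputs
    (hAne : ∀ x₀ ∈ X, (∃ c : ℝ, ∀ z ∈ frontier G, x₀ z = c) → (A x₀).Nonempty)
    (hAmem : ∀ x₀ ∈ X, ∀ u ∈ A x₀, IsBdryInput G u ∧ ∀ z ∈ frontier G, u 0 z = x₀ z)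
    (hAconst : ∀ x₀ ∈ X, ∀ c : ℝ, (∀ z ∈ frontier G, x₀ z = c) →
      ∀ u : ℝ → EuclideanSpace ℝ (Fin n) → ℝ, IsBdryInput G u →
        (∀ t ≥ (0:ℝ), ∀ z ∈ frontier G, u t z = c) → u ∈ A x₀)
    -- Hypothesis (H1): `φ` yields classical solutions with time-slices in `X`
    (hφ : ∀ x₀ ∈ X, ∀ u ∈ A x₀,
      ContinuousOn (fun q : ℝ × EuclideanSpace ℝ (Fin n) => φ x₀ u q.1 q.2)
        (Ici 0 ×ˢ closure G) ∧
      C12On (φ x₀ u) (Ioi 0 ×ˢ G) ∧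
      (∀ q ∈ (Ioi (0:ℝ)) ×ˢ G, Lop a f (φ x₀ u) q.1 q.2 = 0) ∧
      (∀ z ∈ G, φ x₀ u 0 z = x₀ z) ∧
      (∀ t ≥ (0:ℝ), ∀ z ∈ frontier G, φ x₀ u t z = u t z) ∧
      (∀ t ≥ (0:ℝ), φ x₀ u t ∈ X))
    -- Hypothesis (H3)
    (hH3 : ∀ δ > (0:ℝ), ∀ c : ℝ, ∀ x ∈ X, ∃ k : EuclideanSpace ℝ (Fin n) → ℝ,
      ContinuousOn k (closure G) ∧ (∀ z ∈ closure G, k z ∈ Icc (0:ℝ) 1) ∧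
      (∀ z ∈ frontier G, k z = 1) ∧
      (∀ z ∈ closure G, δ ≤ Metric.infDist z (frontier G) → k z = 0) ∧
      (fun z => (1 - k z) * x z + c * k z) ∈ X)
    :
    (BdryExpISSwrt G p X A φ (univ : Set (ℝ → EuclideanSpace ℝ (Fin n) → ℝ)) ↔
      BdryExpISSwrt G p X A φ (ConstInputs G)) ∧
    (BdryExpISSwrt G p X A φ (ConstInputs G) ↔
      (∃ M > (0:ℝ), ∃ lam > (0:ℝ), ∃ γ : ℝ → ℝ, ClassKInf γ ∧
        ∀ y₀ ∈ X, (∀ z ∈ frontier G, y₀ z = 0) → ∀ c : ℝ, ∀ t ≥ (0:ℝ),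
          Xnorm G p (fun z => φ (fun w => y₀ w + c) (fun _ _ => c) t z - c) ≤
            M * Real.exp (-lam * t) * Xnorm G p y₀ + γ |c|)) := by
  -- comparison for trajectories
  have hcmp : ∀ x₀ ∈ X, ∀ u ∈ A x₀, ∀ y₀ ∈ X, ∀ v ∈ A y₀, (∀ z ∈ G, x₀ z ≤ y₀ z) →
      (∀ t ≥ (0:ℝ), ∀ z ∈ frontier G, u t z ≤ v t z) →
      ∀ t ≥ (0:ℝ), ∀ z ∈ closure G, φ x₀ u t z ≤ φ y₀ v t z := by
    intro x₀ hx₀ u hu y₀ hy₀ v hv h0 hb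
    obtain ⟨c1, d1, l1, i1, b1, _⟩ := hφ x₀ hx₀ u hu
    obtain ⟨c2, d2, l2, i2, b2, _⟩ := hφ y₀ hy₀ v hv
    refine aux_comparison hGopen hGbdd hpar hlip c1 c2 d1 d2 l1 l2 ?_ ?_
    · intro z hz
      rw [i1 z hz, i2 z hz]
      exact h0 z hz
    · intro t ht z hz
      rw [b1 t ht z hz, b2 t ht z hz]
      exact hb t ht z hz
  have hφX : ∀ x₀ ∈ X, ∀ u ∈ A x₀, ∀ t ≥ (0:ℝ), ContinuousOn (φ x₀ u t) (closure G) :=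
    fun x₀ hx₀ u hu t ht => hXcont _ ((hφ x₀ hx₀ u hu).2.2.2.2.2 t ht)
  set V : ℝ := Xnorm G p (fun _ => 1) with hV
  have hV0 : 0 ≤ V := ENNReal.toReal_nonneg
  have hconst : ∀ c : ℝ, Xnorm G p (fun _ => c) = V * |c| := aux_Xnorm_const G p
  have hXn0 : ∀ x, 0 ≤ Xnorm G p x := fun x => ENNReal.toReal_nonneg
  refine ⟨⟨?_, ?_⟩, ⟨?_, ?_⟩⟩
  · -- (i) → (ii)
    rintro ⟨M, hM, lam, hlam, γ, hγ, h⟩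
    exact ⟨M, hM, lam, hlam, γ, hγ, fun x₀ hx₀ u hu => h x₀ hx₀ u ⟨hu.1, mem_univ _⟩⟩
  · -- (ii) → (i)
    rintro ⟨M, hM, lam, hlam, γ, hγ, h⟩
    rcases (frontier G).eq_empty_or_nonempty with hemp | hne
    · refine ⟨M, hM, lam, hlam, γ, hγ, fun x₀ hx₀ u hu => h x₀ hx₀ u ⟨hu.1, 0, ?_⟩⟩
      intro t _ z hz
      rw [hemp] at hz
      exact hz.elim
    refine ⟨2 * M, by positivity, lam, hlam, fun r => (2 * M * V) * r + 2 * γ r,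
      aux_KInf hγ (by positivity) (by norm_num), ?_⟩
    rintro x₀ hx₀ u ⟨hu, -⟩ t ht
    obtain ⟨hub, hu0⟩ := hAmem x₀ hx₀ u hu
    set U := bdryNorm G u with hU
    have hU0 : 0 ≤ U := aux_bdryNorm_nonneg G u
    have hx₀c := hXcont x₀ hx₀
    have hx₀b : ∀ z ∈ frontier G, |x₀ z| ≤ U := by
      intro z hz
      rw [← hu0 z hz]
      exact aux_bdryNorm_ge hub le_rfl hz
    have hexp1 : Real.exp (-lam * t) ≤ 1 := by
      rw [Real.exp_le_one_iff]
      nlinarith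
    have hexp0 := Real.exp_pos (-lam * t)
    -- estimate of one constant-input comparison trajectory
    have hone : ∀ ε > (0:ℝ), ∀ c : ℝ, |c| = U + ε → ∀ y₀ ∈ X, (∀ z ∈ frontier G, y₀ z = c) →
        (∀ z ∈ G, |y₀ z| ≤ |x₀ z| + |c|) →
        Xnorm G p (φ y₀ (fun _ _ => c) t) ≤
          M * Real.exp (-lam * t) * Xnorm G p x₀ + (M * V * (U + ε) + γ (U + ε)) := by
      intro ε hε c hc y₀ hy₀ hyb hyle
      have hA : (fun _ _ => c) ∈ A y₀ :=
        hAconst y₀ hy₀ c hyb _ (aux_constInput G c) (fun _ _ _ _ => rfl)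
      have h1 := h y₀ hy₀ _ ⟨hA, c, fun _ _ _ _ => rfl⟩ t ht
      have h2 : γ (bdryNorm G (fun _ _ => c)) ≤ γ (U + ε) := by
        refine hγ.1.2.1.monotoneOn (aux_bdryNorm_nonneg _ _) (by simp; positivity) ?_
        rw [← hc]
        exact aux_bdryNorm_le (fun _ _ _ _ => rfl)
      have h3 : Xnorm G p y₀ ≤ Xnorm G p x₀ + V * (U + ε) := by
        rw [← hc, ← hconst c]
        exact aux_Xnorm_le hGopen hGbdd hp hx₀c continuousOn_const hyle
      have h4 : M * Real.exp (-lam * t) * Xnorm G p y₀ ≤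
          M * Real.exp (-lam * t) * Xnorm G p x₀ + M * V * (U + ε) := by
        calc M * Real.exp (-lam * t) * Xnorm G p y₀
            ≤ M * Real.exp (-lam * t) * (Xnorm G p x₀ + V * (U + ε)) := by gcongr
          _ = M * Real.exp (-lam * t) * Xnorm G p x₀
              + Real.exp (-lam * t) * (M * V * (U + ε)) := by ring
          _ ≤ M * Real.exp (-lam * t) * Xnorm G p x₀ + 1 * (M * V * (U + ε)) := by gcongr
          _ = _ := by ring
      linarith
    have hmain : ∀ ε > (0:ℝ), Xnorm G p (φ x₀ u t) ≤
        2 * M * Real.exp (-lam * t) * Xnorm G p x₀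
          + ((2 * M * V) * (U + ε) + 2 * γ (U + ε)) := by
      intro ε hε
      obtain ⟨δ, hδ, hnear⟩ := aux_near hGbdd hne hx₀c hε hx₀b
      have hkey : ∀ k : EuclideanSpace ℝ (Fin n) → ℝ, ∀ c : ℝ,
          (∀ z ∈ closure G, k z ∈ Icc (0:ℝ) 1) →
          ∀ z ∈ G, |(1 - k z) * x₀ z + c * k z| ≤ |x₀ z| + |c| := by
        intro k c hk z hz
        obtain ⟨ha, hb⟩ := hk z (subset_closure hz)
        refine (abs_add_le _ _).trans ?_
        rw [abs_mul, abs_mul, abs_of_nonneg ha, abs_of_nonneg (by linarith : 0 ≤ 1 - k z)]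
        have := abs_nonneg (x₀ z)
        have := abs_nonneg c
        nlinarith
      obtain ⟨k, hkc, hk01, hkb, hk0, hkX⟩ := hH3 δ hδ (U + ε) x₀ hx₀
      obtain ⟨l, hlc, hl01, hlb, hl0, hlX⟩ := hH3 δ hδ (-(U + ε)) x₀ hx₀
      have hyb : ∀ z ∈ frontier G, (fun z => (1 - k z) * x₀ z + (U + ε) * k z) z = U + ε := by
        intro z hz
        simp [hkb z hz]
      have hyb' : ∀ z ∈ frontier G,
          (fun z => (1 - l z) * x₀ z + (-(U + ε)) * l z) z = -(U + ε) := by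
        intro z hz
        simp [hlb z hz]
      have hAk : (fun _ _ => U + ε) ∈ A (fun z => (1 - k z) * x₀ z + (U + ε) * k z) :=
        hAconst _ hkX (U + ε) hyb _ (aux_constInput G _) (fun _ _ _ _ => rfl)
      have hAl : (fun _ _ => -(U + ε)) ∈ A (fun z => (1 - l z) * x₀ z + (-(U + ε)) * l z) :=
        hAconst _ hlX (-(U + ε)) hyb' _ (aux_constInput G _) (fun _ _ _ _ => rfl)
      have e1 := hone ε hε (U + ε) (abs_of_nonneg (by positivity)) _ hkX hyb
        (hkey k _ hk01)
      have e2 := hone ε hε (-(U + ε)) (by rw [abs_neg]; exact abs_of_nonneg (by positivity))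
        _ hlX hyb' (hkey l _ hl01)
      have c1 := hcmp x₀ hx₀ u hu _ hkX _ hAk (by
        intro z hz
        have hzc := subset_closure hz
        have h01 := hk01 z hzc
        rcases lt_or_ge (Metric.infDist z (frontier G)) δ with hlt | hge
        · have := (abs_le.1 (hnear z hzc hlt)).2
          have := mul_nonneg h01.1 (sub_nonneg.2 this)
          linarith
        · simp [hk0 z hzc hge]) (by
        intro s hs z hz
        have := aux_bdryNorm_ge hub hs hz
        have := le_abs_self (u s z)
        linarith) t ht
      have c2 := hcmp _ hlX _ hAl x₀ hx₀ u hu (by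
        intro z hz
        have hzc := subset_closure hz
        have h01 := hl01 z hzc
        rcases lt_or_ge (Metric.infDist z (frontier G)) δ with hlt | hge
        · have := (abs_le.1 (hnear z hzc hlt)).1
          have := mul_nonneg h01.1 (by linarith : 0 ≤ x₀ z + (U + ε))
          linarith
        · simp [hl0 z hzc hge]) (by
        intro s hs z hz
        have := aux_bdryNorm_ge hub hs hz
        have := neg_abs_le (u s z)
        linarith) t ht
      have e3 := aux_Xnorm_le hGopen hGbdd hp (h := φ x₀ u t) (hφX _ hkX _ hAk t ht)
        (hφX _ hlX _ hAl t ht) (by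
        intro z hz
        have hzc := subset_closure hz
        have q1 := c1 z hzc
        have q2 := c2 z hzc
        have q3 := abs_le_max_abs_abs q2 q1
        refine q3.trans (max_le ?_ ?_)
        · exact le_add_of_nonneg_left (abs_nonneg _)
        · exact le_add_of_nonneg_right (abs_nonneg _))
      linarith
    -- let ε → 0
    have hcont : ContinuousWithinAt (fun r => 2 * M * Real.exp (-lam * t) * Xnorm G p x₀
        + ((2 * M * V) * r + 2 * γ r)) (Ici U) U := by
      have hγc : ContinuousWithinAt γ (Ici U) U :=
        (hγ.1.1 U hU0).mono (Ici_subset_Ici.2 hU0)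
      exact continuousWithinAt_const.add
        ((continuousWithinAt_const.mul continuousWithinAt_id).add
          (continuousWithinAt_const.mul hγc))
    have hlim := (hcont.mono Ioi_subset_Ici_self).tendsto
    refine ge_of_tendsto hlim ?_
    filter_upwards [self_mem_nhdsWithin] with r hr
    have := hmain (r - U) (sub_pos.2 hr)
    simpa using this
  · -- (ii) → (iii)
    rintro ⟨M, hM, lam, hlam, γ, hγ, h⟩
    refine ⟨M, hM, lam, hlam, fun r => (M * V + V) * r + 1 * γ r,
      aux_KInf hγ (by positivity) (by norm_num), ?_⟩
    intro y₀ hy₀ hyb c t ht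
    have hX : (fun w => y₀ w + c) ∈ X := hXadd y₀ hy₀ _ (hXconst c)
    have hA : (fun _ _ => c) ∈ A (fun w => y₀ w + c) :=
      hAconst _ hX c (fun z hz => by simp [hyb z hz]) _ (aux_constInput G c)
        (fun _ _ _ _ => rfl)
    have h1 := h _ hX _ ⟨hA, c, fun _ _ _ _ => rfl⟩ t ht
    have h2 : γ (bdryNorm G (fun _ _ => c)) ≤ γ |c| :=
      hγ.1.2.1.monotoneOn (aux_bdryNorm_nonneg _ _) (abs_nonneg c)
        (aux_bdryNorm_le (fun _ _ _ _ => rfl))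
    have h3 : Xnorm G p (fun w => y₀ w + c) ≤ Xnorm G p y₀ + V * |c| := by
      rw [← hconst c]
      exact aux_Xnorm_le hGopen hGbdd hp (hXcont _ hy₀) continuousOn_const
        (fun z _ => abs_add_le _ _)
    have h4 : Xnorm G p (fun z => φ (fun w => y₀ w + c) (fun _ _ => c) t z - c) ≤
        Xnorm G p (φ (fun w => y₀ w + c) (fun _ _ => c) t) + V * |c| := by
      rw [← hconst c]
      exact aux_Xnorm_le hGopen hGbdd hp (hφX _ hX _ hA t ht) continuousOn_const
        (fun z _ => abs_sub _ _)
    have hexp1 : Real.exp (-lam * t) ≤ 1 := by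
      rw [Real.exp_le_one_iff]
      nlinarith
    have hexp0 := Real.exp_pos (-lam * t)
    have h5 : M * Real.exp (-lam * t) * Xnorm G p (fun w => y₀ w + c) ≤
        M * Real.exp (-lam * t) * Xnorm G p y₀ + M * V * |c| := by
      calc M * Real.exp (-lam * t) * Xnorm G p (fun w => y₀ w + c)
          ≤ M * Real.exp (-lam * t) * (Xnorm G p y₀ + V * |c|) := by gcongr
        _ = M * Real.exp (-lam * t) * Xnorm G p y₀
            + Real.exp (-lam * t) * (M * V * |c|) := by ring
        _ ≤ M * Real.exp (-lam * t) * Xnorm G p y₀ + 1 * (M * V * |c|) := by gcongr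
        _ = _ := by ring
    linarith
  · -- (iii) → (ii)
    rintro ⟨M, hM, lam, hlam, γ, hγ, h⟩
    refine ⟨M, hM, lam, hlam, fun r => (M * V + V) * r + 1 * γ r,
      aux_KInf hγ (by positivity) (by norm_num), ?_⟩
    rintro x₀ hx₀ u ⟨hu, hucst⟩ t ht
    obtain ⟨hub, hu0⟩ := hAmem x₀ hx₀ u hu
    obtain ⟨c, hc, hcU⟩ : ∃ c : ℝ, (∀ t ≥ (0:ℝ), ∀ z ∈ frontier G, u t z = c) ∧
        |c| ≤ bdryNorm G u := by
      rcases (frontier G).eq_empty_or_nonempty with hemp | ⟨z, hz⟩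
      · refine ⟨0, ?_, by simpa using aux_bdryNorm_nonneg G u⟩
        intro t _ z hz
        rw [hemp] at hz
        exact hz.elim
      · obtain ⟨c, hc⟩ := hucst
        refine ⟨c, hc, ?_⟩
        rw [← hc 0 le_rfl z hz]
        exact aux_bdryNorm_ge hub le_rfl hz
    have hx₀b : ∀ z ∈ frontier G, x₀ z = c := fun z hz => by
      rw [← hu0 z hz, hc 0 le_rfl z hz]
    have hA : (fun _ _ => c) ∈ A x₀ :=
      hAconst _ hx₀ c hx₀b _ (aux_constInput G c) (fun _ _ _ _ => rfl)
    have hyX : (fun z => x₀ z + -c) ∈ X := hXadd x₀ hx₀ _ (hXconst (-c))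
    have h1 := h _ hyX (fun z hz => by simp [hx₀b z hz]) c t ht
    simp only [neg_add_cancel_right] at h1
    have heq : Xnorm G p (φ x₀ u t) = Xnorm G p (φ x₀ (fun _ _ => c) t) := by
      refine aux_Xnorm_congr hGopen fun z hz => le_antisymm ?_ ?_
      · exact hcmp x₀ hx₀ u hu x₀ hx₀ _ hA (fun _ _ => le_rfl)
          (fun s hs w hw => (hc s hs w hw).le) t ht z (subset_closure hz)
      · exact hcmp x₀ hx₀ _ hA x₀ hx₀ u hu (fun _ _ => le_rfl)
          (fun s hs w hw => (hc s hs w hw).ge) t ht z (subset_closure hz)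
    have hφc := hφX _ hx₀ _ hA t ht
    have h2 : Xnorm G p (φ x₀ (fun _ _ => c) t) ≤
        Xnorm G p (fun z => φ x₀ (fun _ _ => c) t z - c) + V * |c| := by
      rw [← hconst c]
      exact aux_Xnorm_le hGopen hGbdd hp (hφc.sub continuousOn_const) continuousOn_const
        (fun z _ => by simpa using abs_add_le (φ x₀ (fun _ _ => c) t z - c) c)
    have h3 : Xnorm G p (fun z => x₀ z + -c) ≤ Xnorm G p x₀ + V * |c| := by
      rw [← abs_neg c, ← hconst (-c)]
      exact aux_Xnorm_le hGopen hGbdd hp (hXcont _ hx₀) continuousOn_const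
        (fun z _ => abs_add_le _ _)
    have hexp1 : Real.exp (-lam * t) ≤ 1 := by
      rw [Real.exp_le_one_iff]
      nlinarith
    have hexp0 := Real.exp_pos (-lam * t)
    have h5 : M * Real.exp (-lam * t) * Xnorm G p (fun z => x₀ z + -c) ≤
        M * Real.exp (-lam * t) * Xnorm G p x₀ + M * V * |c| := by
      calc M * Real.exp (-lam * t) * Xnorm G p (fun z => x₀ z + -c)
          ≤ M * Real.exp (-lam * t) * (Xnorm G p x₀ + V * |c|) := by gcongr
        _ = M * Real.exp (-lam * t) * Xnorm G p x₀
            + Real.exp (-lam * t) * (M * V * |c|) := by ring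
        _ ≤ M * Real.exp (-lam * t) * Xnorm G p x₀ + 1 * (M * V * |c|) := by gcongr
        _ = _ := by ring
    have h6 : (M * V + V) * |c| + 1 * γ |c| ≤
        (M * V + V) * bdryNorm G u + 1 * γ (bdryNorm G u) := by
      have := hγ.1.2.1.monotoneOn (abs_nonneg c) (aux_bdryNorm_nonneg G u) hcU
      gcongr
    rw [heq]
    simp only
    linarith

end
end
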